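/- Suppose H is basic and additionally b_j > 0 for every j ≠ 0. Let n ≥ 1 be an integer with M_H(n) ≠ 1, and suppose the rational number χ_H(n)/(1 − M_H(n)) is equal to an integer x. Then x is a periodic point of H: there exists m ≥ 1 with H^{∘m}(x) = x. Moreover, x > 0 if and only if M_H(n) < 1, and x < 0 if and only if M_H(n) > 1. -/

import Mathlib

/-- `qH ϱ a` is the greatest common divisor of the set `{a_j : j < ϱ, a_j ≠ 1}`. -/
def qH (ϱ : ℕ) (a : ℕ → ℤ) : ℤ :=
  Finset.gcd ((Finset.range ϱ).filter fun j => a j ≠ 1) a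

/-- `Mstr a d l = ∏_{k=1}^{L} a_{j_k}/d_{j_k}` for the string `l = (j_1, …, j_L)`. -/
def Mstr (a d : ℕ → ℤ) (l : List ℕ) : ℚ :=
  (l.map fun j => (a j : ℚ) / (d j : ℚ)).prod

/-- `chiStr a b d l = Σ_{m=1}^{L} (b_{j_m}/d_{j_m}) ∏_{k=1}^{m−1} a_{j_k}/d_{j_k}`. -/
def chiStr (a b d : ℕ → ℤ) (l : List ℕ) : ℚ :=
  ∑ m ∈ Finset.range l.length,
    ((l.map fun j => (b j : ℚ) / (d j : ℚ)).getD m 0) * Mstr a d (l.take m)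

/-- `MH a d ϱ n = M_H(n)` via the base-`ϱ` digit string of `n`. -/
def MH (a d : ℕ → ℤ) (ϱ n : ℕ) : ℚ := Mstr a d (Nat.digits ϱ n)

/-- `chiH a b d ϱ n = χ_H(n)` via the base-`ϱ` digit string of `n`. -/
def chiH (a b d : ℕ → ℤ) (ϱ n : ℕ) : ℚ := chiStr a b d (Nat.digits ϱ n)

theorem Mstr_cons (a d : ℕ → ℤ) (j : ℕ) (l : List ℕ) :
    Mstr a d (j :: l) = (a j : ℚ) / d j * Mstr a d l := by
  simp [Mstr]

theorem chiStr_cons (a b d : ℕ → ℤ) (j : ℕ) (l : List ℕ) :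
    chiStr a b d (j :: l) = (b j : ℚ) / d j + (a j : ℚ) / d j * chiStr a b d l := by
  unfold chiStr
  rw [List.length_cons, Finset.sum_range_succ', Finset.mul_sum, add_comm]
  congr 1
  · simp [Mstr]
  · refine Finset.sum_congr rfl fun m _ => ?_
    rw [List.take_succ_cons, Mstr_cons, List.map_cons, List.getD_cons_succ]
    ring

theorem Mstr_pos {a d : ℕ → ℤ} {l : List ℕ} (ha : ∀ j ∈ l, 0 < a j) (hd : ∀ j ∈ l, 0 < d j) :
    0 < Mstr a d l := by
  refine List.prod_pos fun q hq => ?_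
  obtain ⟨j, hj, rfl⟩ := List.mem_map.1 hq
  exact div_pos (mod_cast ha j hj) (mod_cast hd j hj)

theorem chiStr_nonneg {a b d : ℕ → ℤ} {l : List ℕ} (ha : ∀ j ∈ l, 0 < a j)
    (hd : ∀ j ∈ l, 0 < d j) (hb : ∀ j ∈ l, 0 ≤ b j) : 0 ≤ chiStr a b d l := by
  induction l with
  | nil => simp [chiStr]
  | cons j l ih =>
    simp only [List.forall_mem_cons] at ha hd hb
    have ha' : (0 : ℚ) < a j := mod_cast ha.1
    have hd' : (0 : ℚ) < d j := mod_cast hd.1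
    have hb' : (0 : ℚ) ≤ b j := mod_cast hb.1
    have := ih ha.2 hd.2 hb.2
    rw [chiStr_cons]
    positivity

theorem chiStr_pos {a b d : ℕ → ℤ} {l : List ℕ} (ha : ∀ j ∈ l, 0 < a j)
    (hd : ∀ j ∈ l, 0 < d j) (hb : ∀ j ∈ l, 0 ≤ b j) (hex : ∃ j ∈ l, 0 < b j) :
    0 < chiStr a b d l := by
  induction l with
  | nil => simp at hex
  | cons j l ih =>
    simp only [List.forall_mem_cons] at ha hd hb
    have ha' : (0 : ℚ) < a j := mod_cast ha.1
    have hd' : (0 : ℚ) < d j := mod_cast hd.1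
    have hb' : (0 : ℚ) ≤ b j := mod_cast hb.1
    have hnn := chiStr_nonneg ha.2 hd.2 hb.2
    rw [chiStr_cons]
    rcases (List.exists_mem_cons_iff _ _ _).1 hex with h | h
    · have : (0 : ℚ) < b j := mod_cast h
      positivity
    · have := ih ha.2 hd.2 hb.2 h
      positivity

/-- The affine map attached to a string sends integers into `ℤ[1/r]`. -/
theorem exists_pow_length_mul_eq_intCast (a b : ℕ → ℤ) {r : ℤ} (hr : r ≠ 0) (l : List ℕ)
    (y : ℤ) :
    ∃ N : ℤ, (r : ℚ) ^ l.length *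
      (Mstr a (fun _ => r) l * y + chiStr a b (fun _ => r) l) = N := by
  induction l with
  | nil => exact ⟨y, by simp [Mstr, chiStr]⟩
  | cons j l ih =>
    obtain ⟨N, hN⟩ := ih
    have hr' : (r : ℚ) ≠ 0 := mod_cast hr
    refine ⟨a j * N + r ^ l.length * b j, ?_⟩
    push_cast
    rw [← hN, Mstr_cons, chiStr_cons, List.length_cons, pow_succ]
    field_simp
    ring

/-- If the affine map attached to a string of digits sends an integer `y` to an integer `z`,
then iterating `H` along the string also takes `y` to `z`. -/
theorem iterate_length_eq_of_affine_eq {r : ℕ} (hr : 0 < r) {a b : ℕ → ℤ}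
    (hcop : ∀ j < r, Int.gcd (a j) (r : ℤ) = 1)
    (hint : ∀ j < r, ∀ k : ℤ, (r : ℤ) ∣ (a j * k + b j) → k % (r : ℤ) = (j : ℤ))
    {H : ℤ → ℤ}
    (hH : ∀ n : ℤ, (r : ℤ) * H n = a (n % (r : ℤ)).toNat * n + b (n % (r : ℤ)).toNat)
    {l : List ℕ} (hl : ∀ j ∈ l, j < r) {y z : ℤ}
    (hz : Mstr a (fun _ => (r : ℤ)) l * y + chiStr a b (fun _ => (r : ℤ)) l = (z : ℚ)) :
    H^[l.length] y = z := by
  induction l generalizing z with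
  | nil => simpa [Mstr, chiStr] using hz
  | cons j l ih =>
    simp only [List.forall_mem_cons] at hl
    have hr0 : (r : ℤ) ≠ 0 := mod_cast hr.ne'
    have hrq : ((r : ℤ) : ℚ) ≠ 0 := mod_cast hr0
    obtain ⟨N, hN⟩ := exists_pow_length_mul_eq_intCast a b hr0 l y
    set w : ℚ := Mstr a (fun _ => (r : ℤ)) l * y + chiStr a b (fun _ => (r : ℤ)) l with hw
    have hstep : (a j : ℚ) * w + b j = (r : ℤ) * z := by
      rw [← hz, Mstr_cons, chiStr_cons, hw]
      field_simp
      ring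
    have hmul : a j * N = (r : ℤ) ^ l.length * (r * z - b j) := by
      have : (a j : ℚ) * N = ((r : ℤ) : ℚ) ^ l.length * ((r : ℤ) * z - b j) := by
        rw [← hN, ← hstep]
        ring
      exact_mod_cast this
    have hc : IsCoprime ((r : ℤ) ^ l.length) (a j) :=
      (Int.isCoprime_iff_gcd_eq_one.2 (hcop j hl.1)).symm.pow_left
    obtain ⟨v, hv⟩ := hc.dvd_of_dvd_mul_left ⟨_, hmul⟩
    have hwv : w = v := by
      rw [hv, Int.cast_mul, Int.cast_pow] at hN
      exact mul_left_cancel₀ (pow_ne_zero _ hrq) hN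
    have hvz : a j * v + b j = r * z := by
      rw [hwv] at hstep
      exact_mod_cast hstep
    have hmod := hint j hl.1 v ⟨z, hvz⟩
    have hHv := hH v
    rw [hmod, Int.toNat_natCast, hvz] at hHv
    rw [List.length_cons, Function.iterate_succ_apply', ih hl.2 hwv]
    exact mul_left_cancel₀ hr0 hHv

/-- suppose `H` is basic with `b_j > 0` for every `j ≠ 0`. Let
`n ≥ 1` with `M_H(n) ≠ 1`, and suppose `χ_H(n)/(1 − M_H(n))` equals an integer
`x`. Then `x` is a periodic point of `H`; moreover `x > 0 ↔ M_H(n) < 1` and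
`x < 0 ↔ M_H(n) > 1`. -/
theorem stmt14 (ϱ : ℕ) (hϱ : 2 ≤ ϱ) (a b : ℕ → ℤ)
    (ha : ∀ j < ϱ, 0 < a j) (hb0 : b 0 = 0)
    (hbpos : ∀ j, 0 < j → j < ϱ → 0 < b j)
    (hcop : ∀ j < ϱ, Int.gcd (a j) (ϱ : ℤ) = 1)
    (hnd : ∀ j, 0 < j → j < ϱ → a j ≠ 1)
    (hq : (2 : ℤ) ≤ qH ϱ a)
    (hint : ∀ j < ϱ, ∀ ℓ : ℤ, (ϱ : ℤ) ∣ (a j * ℓ + b j) ↔ ℓ % (ϱ : ℤ) = (j : ℤ))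
    (H : ℤ → ℤ)
    (hH : ∀ n : ℤ, (ϱ : ℤ) * H n
        = a (n % (ϱ : ℤ)).toNat * n + b (n % (ϱ : ℤ)).toNat)
    (n : ℕ) (hn : 1 ≤ n) (hM : MH a (fun _ => (ϱ : ℤ)) ϱ n ≠ 1)
    (x : ℤ)
    (hx : (x : ℚ) = chiH a b (fun _ => (ϱ : ℤ)) ϱ n
        / (1 - MH a (fun _ => (ϱ : ℤ)) ϱ n)) :
    (∃ m : ℕ, 1 ≤ m ∧ H^[m] x = x)
    ∧ (0 < x ↔ MH a (fun _ => (ϱ : ℤ)) ϱ n < 1)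
    ∧ (x < 0 ↔ 1 < MH a (fun _ => (ϱ : ℤ)) ϱ n) := by
  have hr : 0 < ϱ := by omega
  have hdig : ∀ j ∈ Nat.digits ϱ n, j < ϱ := fun j hj => Nat.digits_lt_base hϱ hj
  have hne : Nat.digits ϱ n ≠ [] := Nat.digits_ne_nil_iff_ne_zero.2 (by omega)
  have hb : ∀ j < ϱ, 0 ≤ b j := fun j hj => by
    rcases Nat.eq_zero_or_pos j with rfl | h0
    · exact hb0.ge
    · exact (hbpos j h0 hj).le
  have hlast := Nat.getLast_digit_ne_zero ϱ (m := n) (by omega)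
  have hmem := List.getLast_mem hne
  have hchi : 0 < chiH a b (fun _ => (ϱ : ℤ)) ϱ n :=
    chiStr_pos (fun j hj => ha j (hdig j hj)) (fun _ _ => mod_cast hr)
      (fun j hj => hb j (hdig j hj))
      ⟨_, hmem, hbpos _ (Nat.pos_of_ne_zero hlast) (hdig _ hmem)⟩
  refine ⟨⟨(Nat.digits ϱ n).length, List.length_pos_iff.2 hne, ?_⟩, ?_, ?_⟩
  · refine iterate_length_eq_of_affine_eq hr hcop (fun j hj k => (hint j hj k).1) hH hdig ?_
    rw [eq_div_iff (sub_ne_zero.2 hM.symm)] at hx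
    unfold MH chiH at hx
    linarith
  · rw [← Int.cast_pos (R := ℚ), hx, div_pos_iff_of_pos_left hchi, sub_pos]
  · rw [← Int.cast_lt_zero (R := ℚ), hx, div_neg_iff, sub_neg]
    simp [hchi, hchi.not_gt]
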